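/- Fix r ∈ (0,1) and an integer m ≥ 2, let μ₀ be the restriction of planar Lebesgue (area) measure to G_{r,m}, and let J be a compact subset of ∂G_{r,m}. Then, uniformly for z₀ ∈ J, as n → ∞, K_n(z₀, z₀; μ₀) = n²·|z₀|^{2m−2}/(2π r^{2m}) + o(n²). -/

import Mathlib

open MeasureTheory Filter Set Topology ComplexConjugate

noncomputable section

/-- Rising factorial (Pochhammer symbol) `(v)_k`. -/
def risingFac (v : ℂ) (k : ℕ) : ℂ := (ascPochhammer ℂ k).eval v

/-- Real rising factorial. -/
def risingFacR (v : ℝ) (k : ℕ) : ℝ := (ascPochhammer ℝ k).eval v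

/-- The confluent hypergeometric function `₁F₁(a;b;z)`. -/
def oneF1 (a b z : ℂ) : ℂ :=
  ∑' k : ℕ, risingFac a k / risingFac b k * z ^ k / (Nat.factorial k : ℂ)

/-- The terminating Gauss hypergeometric sum `₂F₁(-m, c; d; x)`. -/
def twoF1t (m : ℕ) (c d x : ℂ) : ℂ :=
  ∑ k ∈ Finset.range (m + 1), (m.choose k : ℂ) * (risingFac c k / risingFac d k) * (-x) ^ k

/-- Real version of the terminating Gauss hypergeometric sum. -/
def twoF1tR (m : ℕ) (c d x : ℝ) : ℝ :=
  ∑ k ∈ Finset.range (m + 1), (m.choose k : ℝ) * (risingFacR c k / risingFacR d k) * (-x) ^ k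

/-- The polynomial reproducing kernel built from a family of polynomials. -/
def repKernel (φ : ℕ → Polynomial ℂ) (n : ℕ) (z w : ℂ) : ℂ :=
  ∑ j ∈ Finset.range (n + 1), (φ j).eval z * conj ((φ j).eval w)

/-- `φ` is the family of orthonormal polynomials of `μ`, with (positive real) leading
coefficients `κ`. -/
structure IsOrthonormalPolys (μ : Measure ℂ) (φ : ℕ → Polynomial ℂ) (κ : ℕ → ℝ) : Prop where
  natDegree_eq : ∀ n, (φ n).natDegree = n
  lead_pos : ∀ n, 0 < κ n
  lead_eq : ∀ n, (φ n).leadingCoeff = (κ n : ℂ)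
  orthonormal : ∀ m n, ∫ z, (φ m).eval z * conj ((φ n).eval z) ∂μ = if m = n then 1 else 0

/-- The (closed) support of a measure on `ℂ`. -/
def msupport (μ : Measure ℂ) : Set ℂ := {z | ∀ U : Set ℂ, IsOpen U → z ∈ U → 0 < μ U}

/-- Logarithmic capacity of a compact set, defined via the transfinite diameter. -/
def capacity (K : Set ℂ) : ℝ :=
  ⨅ n : ℕ, ⨆ f : {f : Fin (n + 2) → ℂ // ∀ i, f i ∈ K},
    (∏ p ∈ Finset.univ.filter (fun p : Fin (n + 2) × Fin (n + 2) => p.1 < p.2),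
        ‖f.1 p.1 - f.1 p.2‖) ^ (2 / (((n : ℝ) + 2) * ((n : ℝ) + 1)))

/-- Stahl–Totik regularity of a measure `μ` whose orthonormal polynomials have leading
coefficients `κ`:  `κ n ^ (1/n) → 1 / cap (supp μ)`. -/
def IsRegularST (μ : Measure ℂ) (κ : ℕ → ℝ) : Prop :=
  Tendsto (fun n : ℕ => κ n ^ ((n : ℝ)⁻¹)) atTop (𝓝 (1 / capacity (msupport μ)))

/-- The Christoffel function `λ_n(z; μ)`. -/
def christoffel (μ : Measure ℂ) (n : ℕ) (z : ℂ) : ℝ :=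
  sInf {x : ℝ | ∃ P : Polynomial ℂ, P.natDegree ≤ n ∧ P.eval z = 1 ∧
    x = ∫ w, ‖P.eval w‖ ^ 2 ∂μ}

/-- Arclength measure `dθ` on the unit circle (parametrized over `[0, 2π]`). -/
def circleArc : Measure ℂ :=
  Measure.map (fun θ : ℝ => Complex.exp (Complex.I * θ)) (volume.restrict (Icc (0:ℝ) (2 * Real.pi)))

/-- The measure `w(θ) dθ/(2π)` on the unit circle. -/
def circleAC (w : ℝ → ℝ) : Measure ℂ :=
  Measure.map (fun θ : ℝ => Complex.exp (Complex.I * θ))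
    ((volume.restrict (Icc (0:ℝ) (2 * Real.pi))).withDensity fun θ =>
      ENNReal.ofReal (w θ / (2 * Real.pi)))

/-- The Hua–Pickrell weight. -/
def hpWeight (γ τ : ℝ) (θ : ℝ) : ℝ :=
  (4:ℝ) ^ γ * ‖Complex.Gamma (1 + (γ:ℂ) + Complex.I * (τ:ℂ))‖ ^ 2
      / Real.Gamma (2 * γ + 1)
    * Real.exp ((Real.pi - θ) * τ) * Real.sin (θ / 2) ^ (2 * γ)

/-- The Hua–Pickrell measure on the unit circle. -/
def huaPickrell (γ τ : ℝ) : Measure ℂ := circleAC (hpWeight γ τ)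

/-- The limiting kernel appearing in Theorem 1.1, with the diagonal `a = b̄` interpreted
by continuity. -/
def hpLimitKernel (γ τ : ℝ) (a b : ℂ) : ℂ :=
  let y : ℂ := (γ:ℂ) + Complex.I * (τ:ℂ)
  let c : ℂ := 2 * (γ:ℂ) + 1
  if a = conj b then
    oneF1 (1 + conj y) c (-Complex.I * conj b) * oneF1 (2 + y) (c + 1) (Complex.I * conj b)
        * (1 + y)
      - oneF1 (conj y) c (-Complex.I * conj b) * oneF1 (1 + y) (c + 1) (Complex.I * conj b) * y
  else
    c * (oneF1 (conj y) c (-Complex.I * conj b) * oneF1 y c (Complex.I * a)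
        - oneF1 (1 + conj y) c (-Complex.I * conj b) * oneF1 (1 + y) c (Complex.I * a))
      / (Complex.I * (conj b - a))

/-- The lemniscate region `G_{r,m} = {z : |z^m - 1| < r^m}`. -/
def lemniscate (r : ℝ) (m : ℕ) : Set ℂ := {z : ℂ | ‖z ^ m - 1‖ < r ^ m}

/-- The function `H = ₁F₁(2;3;·)`. -/
def Hfun (t : ℂ) : ℂ := if t = 0 then 1 else 2 * (Complex.exp t * (t - 1) + 1) / t ^ 2

/-- The function `T` of (2.1). -/
def Tfun (γ : ℝ) (a : ℝ) : ℂ :=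
  oneF1 (1 + (γ:ℂ)) (2 * (γ:ℂ) + 1) (-Complex.I * (a:ℂ))
      * oneF1 (2 + (γ:ℂ)) (2 * (γ:ℂ) + 2) (Complex.I * (a:ℂ)) * (1 + (γ:ℂ))
    - oneF1 (γ:ℂ) (2 * (γ:ℂ) + 1) (-Complex.I * (a:ℂ))
      * oneF1 (1 + (γ:ℂ)) (2 * (γ:ℂ) + 2) (Complex.I * (a:ℂ)) * (γ:ℂ)

end

theorem aux_angle (m : ℕ) (hm : 2 ≤ m) (F : ℂ → ENNReal) (hF : Measurable F) (s : ℝ) :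
    ∫⁻ θ in Ioo (-Real.pi) Real.pi, F (s * (Complex.exp (θ * Complex.I)) ^ m)
      = ∫⁻ θ in Ioo (-Real.pi) Real.pi, F (s * Complex.exp (θ * Complex.I)) := by
  have : Fact (0 < 2 * Real.pi) := ⟨by positivity⟩
  have key : ∀ g : AddCircle (2 * Real.pi) → ENNReal,
      ∫⁻ θ in Ioo (-Real.pi) Real.pi, g (θ : AddCircle (2 * Real.pi)) = ∫⁻ b, g b := by
    intro g
    rw [← AddCircle.lintegral_preimage (2 * Real.pi) (-Real.pi) g]
    have : -Real.pi + 2 * Real.pi = Real.pi := by ring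
    rw [this, Measure.restrict_congr_set Ioo_ae_eq_Ioc]
  have hc : ∀ θ : ℝ, ((AddCircle.toCircle (θ : AddCircle (2 * Real.pi)) : Circle) : ℂ)
      = Complex.exp (θ * Complex.I) := by
    intro θ
    rw [AddCircle.toCircle_apply_mk, Circle.coe_exp]
    congr 2
    field_simp
  have h1 := key (fun b => F (s * ((b.toCircle : Circle) : ℂ)))
  have h2 := key (fun b => F (s * ((b.toCircle : Circle) : ℂ) ^ m))
  simp only [hc] at h1 h2
  rw [h1, h2]
  have h3 := (AddCircle.ergodic_nsmul (T := 2 * Real.pi) (n := m) (by omega)).toMeasurePreserving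
  have hmeas : Measurable (fun b : AddCircle (2 * Real.pi) => F (s * ((b.toCircle : Circle) : ℂ))) := by
    apply hF.comp
    apply Continuous.measurable
    have := AddCircle.continuous_toCircle (T := 2 * Real.pi)
    fun_prop
  have h4 := h3.lintegral_comp hmeas
  rw [← h4]
  simp only [AddCircle.toCircle_nsmul, Circle.coe_pow]

theorem aux_polar (F : ℂ → ENNReal) (hF : Measurable F) :
    ∫⁻ z, F z = ∫⁻ t in Ioi (0:ℝ), ENNReal.ofReal t *
      ∫⁻ θ in Ioo (-Real.pi) Real.pi, F (t * Complex.exp (θ * Complex.I)) := by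
  rw [← Complex.lintegral_comp_polarCoord_symm]
  have : polarCoord.target = Ioi (0:ℝ) ×ˢ Ioo (-Real.pi) Real.pi := rfl
  have h2 : ∀ p : ℝ × ℝ, Complex.polarCoord.symm p = p.1 * Complex.exp (p.2 * Complex.I) := by
    intro p
    rw [Complex.polarCoord_symm_apply, Complex.exp_mul_I]
    simp
  have hm1 : Measurable (fun p : ℝ × ℝ => F (p.1 * Complex.exp (p.2 * Complex.I))) :=
    hF.comp (by fun_prop)
  rw [this, Measure.volume_eq_prod, ← Measure.prod_restrict]
  simp only [h2, smul_eq_mul]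
  rw [lintegral_prod _ (by
    apply Measurable.aemeasurable
    exact (ENNReal.measurable_ofReal.comp measurable_fst).mul hm1)]
  apply lintegral_congr
  intro t
  have hh : Measurable (fun θ : ℝ => F ((t:ℂ) * Complex.exp (θ * Complex.I))) :=
    hF.comp (f := fun θ : ℝ => (t:ℂ) * Complex.exp (θ * Complex.I)) (by fun_prop)
  dsimp only
  exact lintegral_const_mul _ hh

theorem aux_cv (m : ℕ) (hm : 2 ≤ m) (F : ℂ → ENNReal) (hF : Measurable F) :
    ∫⁻ z : ℂ, ENNReal.ofReal (m * ‖z‖ ^ (2 * m - 2)) * F (z ^ m) = ∫⁻ z, F z := by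
  rw [aux_polar F hF, aux_polar]
  swap
  · apply Measurable.mul
    · fun_prop
    · exact hF.comp (by fun_prop)
  have him : (fun t : ℝ => t ^ m) '' Ioi 0 = Ioi 0 := by
    ext s
    constructor
    · rintro ⟨t, ht, rfl⟩
      exact pow_pos (mem_Ioi.mp ht) m
    · intro hs
      refine ⟨s ^ ((m:ℝ)⁻¹), Real.rpow_pos_of_pos hs _, ?_⟩
      exact Real.rpow_inv_natCast_pow (le_of_lt hs) (by omega)
  have hcv := lintegral_image_eq_lintegral_abs_deriv_mul (s := Ioi (0:ℝ)) (f := fun t : ℝ => t ^ m)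
    (f' := fun t => m * t ^ (m - 1)) measurableSet_Ioi
    (fun x _ => (hasDerivAt_pow m x).hasDerivWithinAt)
    (fun x hx y hy h => (pow_left_inj₀ (le_of_lt hx) (le_of_lt hy) (by omega)).mp h)
    (fun s => ENNReal.ofReal s *
      ∫⁻ θ in Ioo (-Real.pi) Real.pi, F (s * Complex.exp (θ * Complex.I)))
  rw [him] at hcv
  rw [hcv]
  apply setLIntegral_congr_fun measurableSet_Ioi
  intro t ht
  have ht' : (0:ℝ) < t := ht
  dsimp only
  have hn : ∀ θ : ℝ, ‖(t:ℂ) * Complex.exp (θ * Complex.I)‖ = t := by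
    intro θ
    rw [norm_mul, Complex.norm_exp_ofReal_mul_I, mul_one, Complex.norm_real, Real.norm_of_nonneg ht'.le]
  simp only [hn, mul_pow]
  rw [lintegral_const_mul (f := fun θ : ℝ => F ((t:ℂ) ^ m * Complex.exp (θ * Complex.I) ^ m)) _
    (hF.comp (f := fun θ : ℝ => (t:ℂ) ^ m * Complex.exp (θ * Complex.I) ^ m) (by fun_prop)), ← mul_assoc, ← mul_assoc,
    ← ENNReal.ofReal_mul ht'.le, ← ENNReal.ofReal_mul (abs_nonneg _)]
  have := aux_angle m hm F hF (t ^ m)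
  push_cast at this ⊢
  rw [this]
  congr 2
  rw [abs_of_nonneg (by positivity)]
  obtain ⟨k, rfl⟩ : ∃ k, m = k + 1 := ⟨m - 1, by omega⟩
  have e1 : 2 * (k + 1) - 2 = 2 * k := by omega
  have e2 : k + 1 - 1 = k := by omega
  rw [e1, e2]
  ring

theorem aux_pythag {ι : Type*} [DecidableEq ι] (ν : Measure ℂ) (s : Finset ι) (f : ι → ℂ → ℂ)
    (hint : ∀ i ∈ s, ∀ j ∈ s, Integrable (fun z => f i z * conj (f j z)) ν)
    (horth : ∀ i ∈ s, ∀ j ∈ s, i ≠ j → ∫ z, f i z * conj (f j z) ∂ν = 0) :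
    ∫ z, ‖∑ i ∈ s, f i z‖ ^ 2 ∂ν = ∑ i ∈ s, ∫ z, ‖f i z‖ ^ 2 ∂ν := by
  have key : ∀ w : ℂ, ((‖w‖ ^ 2 : ℝ) : ℂ) = w * conj w := by
    intro w
    rw [Complex.mul_conj, Complex.normSq_eq_norm_sq]
  apply Complex.ofReal_injective
  rw [← integral_complex_ofReal]
  push_cast [← integral_complex_ofReal]
  have key' : ∀ w : ℂ, (‖w‖ : ℂ) ^ 2 = w * conj w := by
    intro w; rw [← key]; push_cast; rfl
  simp only [key', map_sum, Finset.sum_mul_sum]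
  rw [integral_finsetSum _ (fun i hi => integrable_finsetSum _ (fun j hj => hint i hi j hj))]
  apply Finset.sum_congr rfl
  intro i hi
  rw [integral_finsetSum _ (fun j hj => hint i hi j hj)]
  rw [Finset.sum_eq_single_of_mem i hi]
  intro j hj hne
  exact horth i hi j hj hne.symm

theorem aux_rot (S : Set ℂ) (ω c : ℂ) (hω : ‖ω‖ = 1) (hS : ∀ z, ω * z ∈ S ↔ z ∈ S)
    (f : ℂ → ℂ) (hf : ∀ z, f (ω * z) = c * f z) (hc : c ≠ 1) : ∫ z in S, f z = 0 := by
  let e : ℂ ≃ₗᵢ[ℝ] ℂ := rotation ⟨ω, mem_sphere_zero_iff_norm.mpr hω⟩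
  have he : ∀ z, e z = ω * z := fun z => rfl
  have h := (LinearIsometryEquiv.measurePreserving e).setIntegral_preimage_emb
    e.toHomeomorph.measurableEmbedding f S
  have hpre : e ⁻¹' S = S := by
    ext z; rw [mem_preimage, he, hS]
  rw [hpre] at h
  simp only [he, hf] at h
  rw [integral_const_mul] at h
  have : (c - 1) * ∫ z in S, f z = 0 := by rw [sub_mul, h]; ring
  exact (mul_eq_zero.mp this).resolve_left (sub_ne_zero.mpr hc)

theorem aux_int (f : ℂ → ℂ) (hf : Continuous f) (S : Set ℂ) (hS : Bornology.IsBounded S) :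
    IntegrableOn f S := by
  have h1 : IsCompact (closure S) := hS.isCompact_closure
  exact (hf.continuousOn.integrableOn_compact h1).mono_set subset_closure

theorem aux_intR (f : ℂ → ℝ) (hf : Continuous f) (S : Set ℂ) (hS : Bornology.IsBounded S) :
    IntegrableOn f S := by
  have h1 : IsCompact (closure S) := hS.isCompact_closure
  exact (hf.continuousOn.integrableOn_compact h1).mono_set subset_closure

theorem aux_disc_norm (ρ : ℝ) (hρ : 0 < ρ) (l : ℕ) :
    ∫ z in Metric.ball (0:ℂ) ρ, ‖z ^ l‖ ^ 2 = Real.pi * ρ ^ (2 * l + 2) / (l + 1) := by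
  rw [← integral_indicator measurableSet_ball]
  have h1 : (Metric.ball (0:ℂ) ρ).indicator (fun z => ‖z ^ l‖ ^ 2)
      = fun z => (fun t : ℝ => (Iio ρ).indicator (fun t => t ^ (2 * l)) t) ‖z‖ := by
    ext z
    simp only [indicator, mem_ball_zero_iff, mem_Iio, norm_pow]
    split_ifs
    · ring
    · rfl
  rw [h1, integral_fun_norm_addHaar, Complex.finrank_real_complex]
  have h2 : volume.real (Metric.ball (0:ℂ) 1) = Real.pi := by
    simp [measureReal_def, Complex.volume_ball]
  rw [h2]
  have h3 : ∀ y : ℝ, y ^ (2 - 1) • (Iio ρ).indicator (fun t => t ^ (2 * l)) y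
      = (Iio ρ).indicator (fun t => t ^ (2 * l + 1)) y := by
    intro y
    simp only [indicator]
    split_ifs
    · simp [pow_succ]; ring
    · simp
  simp only [h3]
  rw [setIntegral_indicator measurableSet_Iio, Ioi_inter_Iio, ← integral_Ioc_eq_integral_Ioo,
    ← intervalIntegral.integral_of_le hρ.le, integral_pow]
  simp only [nsmul_eq_mul, smul_eq_mul]
  push_cast
  have : (l:ℝ) + 1 ≠ 0 := by positivity
  field_simp
  ring

theorem aux_disc (ρ : ℝ) (hρ : 0 < ρ) (N : ℕ) (b : ℕ → ℂ) :
    ∫ z in Metric.ball (0:ℂ) ρ, ‖∑ l ∈ Finset.range N, b l * z ^ l‖ ^ 2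
      = ∑ l ∈ Finset.range N, ‖b l‖ ^ 2 * (Real.pi * ρ ^ (2 * l + 2) / (l + 1)) := by
  rw [aux_pythag (volume.restrict (Metric.ball (0:ℂ) ρ)) (Finset.range N) (fun l z => b l * z ^ l)]
  · apply Finset.sum_congr rfl
    intro l _
    rw [← aux_disc_norm ρ hρ l, ← integral_const_mul]
    congr 1
    ext z
    rw [norm_mul, mul_pow]
  · intro i _ j _
    exact aux_int _ (by fun_prop) _ Metric.isBounded_ball
  · intro i _ j _ hij
    apply aux_rot _ (Complex.exp ((1:ℝ) * Complex.I)) (Complex.exp (((i:ℝ) - (j:ℝ) : ℝ) * Complex.I))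
      (Complex.norm_exp_ofReal_mul_I 1)
    · intro z
      rw [mem_ball_zero_iff, mem_ball_zero_iff, norm_mul, Complex.norm_exp_ofReal_mul_I, one_mul]
    · intro z
      simp only [mul_pow, map_mul, map_pow, ← Complex.exp_conj, ← Complex.exp_nat_mul]
      have : Complex.exp (((i:ℝ) - (j:ℝ) : ℝ) * Complex.I) =
        Complex.exp (i * ((1:ℝ) * Complex.I)) * Complex.exp (j * ((1:ℝ) * -Complex.I)) := by
        rw [← Complex.exp_add]
        congr 1
        push_cast
        ring
      rw [this]
      simp only [Complex.conj_I, Complex.conj_ofReal, Complex.conj_natCast]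
      ring
    · intro h
      rw [Complex.exp_eq_one_iff] at h
      obtain ⟨n, hn⟩ := h
      have h2 : (((i:ℝ) - j : ℝ) : ℂ) = ((n * (2 * Real.pi) : ℝ) : ℂ) := by
        have := mul_right_cancel₀ (b := Complex.I) Complex.I_ne_zero
          (a := (((i:ℝ) - j : ℝ) : ℂ)) (c := ((n * (2 * Real.pi) : ℝ) : ℂ)) (by rw [hn]; push_cast; ring)
        exact this
      have h3 : (i:ℝ) - j = n * (2 * Real.pi) := Complex.ofReal_injective h2
      have hn0 : n ≠ 0 := by
        rintro rfl
        apply hij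
        have : (i:ℝ) = j := by simp at h3; linarith
        exact_mod_cast this
      apply (irrational_pi)
      refine ⟨((i:ℚ) - j) / (2 * n), ?_⟩
      have : (n:ℝ) ≠ 0 := by exact_mod_cast hn0
      push_cast
      rw [h3]
      field_simp

theorem aux_meas (r : ℝ) (m : ℕ) : MeasurableSet (lemniscate r m) := by
  have : IsOpen (lemniscate r m) := isOpen_lt (by fun_prop) (by fun_prop)
  exact this.measurableSet

theorem aux_normle (r : ℝ) (m : ℕ) (hm : 2 ≤ m) (hr1 : r ^ m < 1) (z : ℂ)
    (hz : ‖z ^ m - 1‖ ≤ r ^ m) : ‖z‖ ≤ 2 := by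
  by_contra h
  push Not at h
  have h1 : ‖z‖ ≤ ‖z‖ ^ m := le_self_pow₀ (by linarith) (by omega)
  have h2 : ‖z ^ m‖ ≤ ‖z ^ m - 1‖ + ‖(1:ℂ)‖ := by
    have := norm_add_le (z ^ m - 1) 1
    simpa using this
  rw [norm_pow, norm_one] at h2
  linarith

theorem aux_bdd (r : ℝ) (m : ℕ) (hm : 2 ≤ m) (hr1 : r ^ m < 1) :
    Bornology.IsBounded (lemniscate r m) := by
  refine (Metric.isBounded_closedBall (x := (0:ℂ)) (r := 2)).subset ?_
  intro z hz
  rw [mem_closedBall_zero_iff]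
  exact aux_normle r m hm hr1 z (le_of_lt hz)

theorem aux_G (r : ℝ) (m : ℕ) (hm : 2 ≤ m) (R : Polynomial ℂ) :
    ∫ z in lemniscate r m, ‖z ^ (m - 1) * R.eval (z ^ m)‖ ^ 2
      = (1 / m) * ∫ u in Metric.ball (1:ℂ) (r ^ m), ‖R.eval u‖ ^ 2 := by
  have hcR : Continuous fun u : ℂ => R.eval u := R.continuous
  have h := aux_cv m hm ((Metric.ball (1:ℂ) (r ^ m)).indicator
    (fun u => ENNReal.ofReal (‖R.eval u‖ ^ 2)))
    (Measurable.indicator (by fun_prop) measurableSet_ball)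
  rw [lintegral_indicator measurableSet_ball] at h
  have h2 : ∀ z : ℂ, ENNReal.ofReal (m * ‖z‖ ^ (2 * m - 2)) *
      (Metric.ball (1:ℂ) (r ^ m)).indicator (fun u => ENNReal.ofReal (‖R.eval u‖ ^ 2)) (z ^ m)
      = (lemniscate r m).indicator
        (fun z => ENNReal.ofReal (m * ‖z ^ (m - 1) * R.eval (z ^ m)‖ ^ 2)) z := by
    intro z
    by_cases hz : z ∈ lemniscate r m
    · have hz' : z ^ m ∈ Metric.ball (1:ℂ) (r ^ m) := by
        rw [mem_ball_iff_norm]; exact hz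
      rw [indicator_of_mem hz, indicator_of_mem hz', ← ENNReal.ofReal_mul (by positivity)]
      congr 1
      rw [norm_mul, norm_pow, mul_pow, ← pow_mul]
      have : (m - 1) * 2 = 2 * m - 2 := by omega
      rw [this]; ring
    · have hz' : z ^ m ∉ Metric.ball (1:ℂ) (r ^ m) := by
        rw [mem_ball_iff_norm]; exact hz
      rw [indicator_of_notMem hz, indicator_of_notMem hz', mul_zero]
  simp only [h2] at h
  rw [lintegral_indicator (aux_meas r m)] at h
  have hm0 : (m:ℝ) ≠ 0 := by positivity
  have e1 : ∫ z in lemniscate r m, (m:ℝ) * ‖z ^ (m - 1) * R.eval (z ^ m)‖ ^ 2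
      = ∫ u in Metric.ball (1:ℂ) (r ^ m), ‖R.eval u‖ ^ 2 := by
    rw [integral_eq_lintegral_of_nonneg_ae, integral_eq_lintegral_of_nonneg_ae, h]
    · exact Eventually.of_forall (fun z => by positivity)
    · exact (Continuous.aestronglyMeasurable (by fun_prop))
    · exact Eventually.of_forall (fun z => by positivity)
    · exact (Continuous.aestronglyMeasurable (by fun_prop))
  rw [← e1, integral_const_mul]
  field_simp

theorem aux_ball (ρ : ℝ) (hρ : 0 < ρ) (R : Polynomial ℂ) (N : ℕ) (hN : R.natDegree < N) :
    ∫ u in Metric.ball (1:ℂ) ρ, ‖R.eval u‖ ^ 2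
      = ∑ l ∈ Finset.range N, ‖(R.taylor 1).coeff l‖ ^ 2 * (Real.pi * ρ ^ (2 * l + 2) / (l + 1)) := by
  rw [← aux_disc ρ hρ]
  have h := (measurePreserving_add_right volume (1:ℂ)).setIntegral_preimage_emb
    (Homeomorph.addRight (1:ℂ)).measurableEmbedding (fun u => ‖R.eval u‖ ^ 2) (Metric.ball (1:ℂ) ρ)
  rw [← h]
  have : (fun x : ℂ => x + 1) ⁻¹' (Metric.ball (1:ℂ) ρ) = Metric.ball 0 ρ := by
    ext z; simp
  rw [this]
  congr 1
  ext z
  rw [← Polynomial.taylor_eval, Polynomial.eval_eq_sum_range' (n := N)]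
  rwa [Polynomial.natDegree_taylor]

/-- partial sums -/
noncomputable def auxSg (N : ℕ) : ℝ := ∑ l ∈ Finset.range N, ((l:ℝ) + 1)

theorem auxSg_eq (N : ℕ) : auxSg N = N * (N + 1) / 2 := by
  unfold auxSg
  induction N with
  | zero => simp
  | succ k ih => rw [Finset.sum_range_succ, ih]; push_cast; ring

theorem aux_point (r : ℝ) (hr0 : 0 < r) (m : ℕ) (hm : 2 ≤ m) (R : Polynomial ℂ) (N : ℕ)
    (hN : R.natDegree < N) (u : ℂ) (hu : ‖u - 1‖ = r ^ m) :
    ‖R.eval u‖ ^ 2 ≤ auxSg N / (Real.pi * r ^ (2 * m)) * (m *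
      ∫ z in lemniscate r m, ‖z ^ (m - 1) * R.eval (z ^ m)‖ ^ 2) := by
  have hm0 : (m:ℝ) ≠ 0 := by positivity
  rw [aux_G r m hm, aux_ball (r ^ m) (by positivity) R N hN, ← mul_assoc, ← mul_assoc]
  rw [show auxSg N / (Real.pi * r ^ (2 * m)) * m * (1 / m) = auxSg N / (Real.pi * r ^ (2 * m)) by
    field_simp]
  have e : R.eval u = ∑ l ∈ Finset.range N, (R.taylor 1).coeff l * (u - 1) ^ l := by
    have := Polynomial.taylor_eval (1:ℂ) R (u - 1)
    rw [sub_add_cancel] at this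
    rw [← this, Polynomial.eval_eq_sum_range' (n := N)]
    rwa [Polynomial.natDegree_taylor]
  have h1 : ‖R.eval u‖ ≤ ∑ l ∈ Finset.range N, ‖(R.taylor 1).coeff l‖ * (r ^ m) ^ l := by
    rw [e]
    refine (norm_sum_le _ _).trans (le_of_eq ?_)
    apply Finset.sum_congr rfl
    intro l _
    rw [norm_mul, norm_pow, hu]
  have h2 := Finset.sum_sq_le_sum_mul_sum_of_sq_le_mul (Finset.range N)
    (r := fun l => ‖(R.taylor 1).coeff l‖ * (r ^ m) ^ l)
    (f := fun l : ℕ => ((l:ℝ) + 1) / (Real.pi * r ^ (2 * m)))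
    (g := fun l => ‖(R.taylor 1).coeff l‖ ^ 2 * (Real.pi * (r ^ m) ^ (2 * l + 2) / (l + 1)))
    (fun i _ => by positivity) (fun i _ => by positivity) (fun i _ => le_of_eq <| by
      have : ((i:ℝ) + 1) ≠ 0 := by positivity
      have := Real.pi_ne_zero
      have := hr0.ne'
      field_simp
      ring)
  rw [← Finset.sum_div] at h2
  exact (pow_le_pow_left₀ (norm_nonneg _) h1 2).trans h2

theorem aux_mod (r : ℝ) (m : ℕ) (hm : 2 ≤ m) (hr1 : r ^ m < 1) (f : ℕ → Polynomial ℂ) :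
    ∫ z in lemniscate r m, ‖∑ j ∈ Finset.range m, z ^ j * (f j).eval (z ^ m)‖ ^ 2
      = ∑ j ∈ Finset.range m, ∫ z in lemniscate r m, ‖z ^ j * (f j).eval (z ^ m)‖ ^ 2 := by
  have hc : ∀ i, Continuous fun u : ℂ => (f i).eval u := fun i => (f i).continuous
  apply aux_pythag (volume.restrict (lemniscate r m)) (Finset.range m)
    (fun j z => z ^ j * (f j).eval (z ^ m))
  · intro i _ j _
    have := hc i
    have := hc j
    exact aux_int _ (by fun_prop) _ (aux_bdd r m hm hr1)
  · intro i hi j hj hij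
    have hprim := Complex.isPrimitiveRoot_exp m (by omega)
    set ω := Complex.exp (2 * Real.pi * Complex.I / m)
    have hωm : ω ^ m = 1 := hprim.pow_eq_one
    have hω1 : ‖ω‖ = 1 := hprim.norm'_eq_one (by omega)
    have hcc : conj ω * ω = 1 := by
      rw [Complex.conj_mul', hω1]; simp
    apply aux_rot _ ω (ω ^ i * (conj ω) ^ j) hω1
    · intro z
      change ‖(ω * z) ^ m - 1‖ < _ ↔ ‖z ^ m - 1‖ < _
      rw [mul_pow, hωm, one_mul]
    · intro z
      simp only [mul_pow, hωm, one_mul, map_mul, map_pow]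
      ring
    · intro h
      apply hij
      apply hprim.pow_inj (Finset.mem_range.mp hi) (Finset.mem_range.mp hj)
      calc ω ^ i = ω ^ i * (conj ω * ω) ^ j := by rw [hcc]; simp
        _ = (ω ^ i * (conj ω) ^ j) * ω ^ j := by ring
        _ = ω ^ j := by rw [h, one_mul]

theorem aux_approx0 (ρ : ℝ) (hρ0 : 0 < ρ) (hρ1 : ρ < 1) (a : ℝ) (δ : ℝ) (hδ : 0 < δ) :
    ∃ S : Polynomial ℂ, ∀ u : ℂ, ‖u - 1‖ ≤ ρ →
      (1 - δ) * ‖u‖ ^ a ≤ ‖S.eval u‖ ∧ ‖S.eval u‖ ≤ (1 + δ) * ‖u‖ ^ a := by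
  have hslit : ∀ u : ℂ, ‖u - 1‖ < 1 → u ∈ Complex.slitPlane := by
    intro u hu
    left
    have := (Complex.abs_re_le_norm (u - 1)).trans_lt hu
    rw [abs_lt] at this
    simp at this
    linarith [this.1]
  have hne : ∀ u : ℂ, ‖u - 1‖ ≤ ρ → 0 < ‖u‖ := by
    intro u hu
    exact norm_pos_iff.mpr (Complex.slitPlane_ne_zero (hslit u (by linarith)))
  have hcont : ContinuousOn (fun u : ℂ => ‖u‖ ^ a) (Metric.closedBall 1 ρ) := by
    intro u hu
    rw [mem_closedBall_iff_norm] at hu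
    exact (continuous_norm.continuousAt.rpow_const (Or.inl (hne u hu).ne')).continuousWithinAt
  obtain ⟨u1, hu1, hmin⟩ := (isCompact_closedBall (1:ℂ) ρ).exists_isMinOn
    ⟨1, Metric.mem_closedBall_self hρ0.le⟩ hcont
  set c := ‖u1‖ ^ a with hc
  have hcpos : 0 < c := Real.rpow_pos_of_pos (hne u1 (by rwa [mem_closedBall_iff_norm] at hu1)) a
  let R : NNReal := ⟨(2 + ρ) / 3, by positivity⟩
  let R' : NNReal := ⟨(1 + 2 * ρ) / 3, by positivity⟩
  have hR : (R:ℝ) = (2 + ρ) / 3 := rfl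
  have hR' : (R':ℝ) = (1 + 2 * ρ) / 3 := rfl
  have hdiff : DifferentiableOn ℂ (fun u : ℂ => u ^ (a:ℂ)) (Metric.closedBall 1 R) := by
    intro u hu
    rw [mem_closedBall_iff_norm, hR] at hu
    exact (differentiableAt_id.cpow_const (hslit u (by linarith))).differentiableWithinAt
  have hps := hdiff.hasFPowerSeriesOnBall (by
    rw [← NNReal.coe_pos, hR]; positivity)
  have hun := hps.tendstoUniformlyOn (r' := R') (by
    rw [ENNReal.coe_lt_coe, ← NNReal.coe_lt_coe, hR, hR']; linarith)
  rw [Metric.tendstoUniformlyOn_iff] at hun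
  obtain ⟨n, hn⟩ := (hun (δ * c) (by positivity)).exists
  set p := cauchyPowerSeries (fun u : ℂ => u ^ (a:ℂ)) 1 R
  refine ⟨∑ k ∈ Finset.range n, Polynomial.C (p.coeff k) * (Polynomial.X - 1) ^ k, ?_⟩
  intro u hu
  have h1 := hn (u - 1) (by rw [mem_ball_zero_iff, hR']; linarith)
  have h2 : p.partialSum n (u - 1) = (∑ k ∈ Finset.range n, Polynomial.C (p.coeff k) *
      (Polynomial.X - 1) ^ k : Polynomial ℂ).eval u := by
    rw [FormalMultilinearSeries.partialSum, Polynomial.eval_finsetSum]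
    apply Finset.sum_congr rfl
    intro k _
    rw [FormalMultilinearSeries.apply_eq_pow_smul_coeff]
    simp [mul_comm]
  rw [h2, add_sub_cancel, dist_eq_norm] at h1
  have h3 : ‖u ^ (a:ℂ)‖ = ‖u‖ ^ a := Complex.norm_cpow_real u a
  have h4 : c ≤ ‖u‖ ^ a := hmin (mem_closedBall_iff_norm.mpr hu)
  have h5 := norm_sub_norm_le (u ^ (a:ℂ)) ((∑ k ∈ Finset.range n, Polynomial.C (p.coeff k) *
      (Polynomial.X - 1) ^ k : Polynomial ℂ).eval u)
  have h6 := norm_sub_norm_le ((∑ k ∈ Finset.range n, Polynomial.C (p.coeff k) *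
      (Polynomial.X - 1) ^ k : Polynomial ℂ).eval u) (u ^ (a:ℂ))
  rw [norm_sub_rev] at h6
  rw [h3] at h5 h6
  have h7 : δ * c ≤ δ * ‖u‖ ^ a := by gcongr
  constructor <;> nlinarith

theorem aux_approx (r : ℝ) (hr0 : 0 < r) (m : ℕ) (hm : 2 ≤ m) (hr1 : r ^ m < 1) (i j : ℕ)
    (δ : ℝ) (hδ : 0 < δ) :
    ∃ S : Polynomial ℂ, ∀ z : ℂ, ‖z ^ m - 1‖ ≤ r ^ m →
      (1 - δ) * ‖z‖ ^ i ≤ ‖z ^ j * S.eval (z ^ m)‖ ∧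
      ‖z ^ j * S.eval (z ^ m)‖ ≤ (1 + δ) * ‖z‖ ^ i := by
  obtain ⟨S, hS⟩ := aux_approx0 (r ^ m) (by positivity) hr1 (((i:ℝ) - j) / m) δ hδ
  refine ⟨S, fun z hz => ?_⟩
  obtain ⟨h1, h2⟩ := hS (z ^ m) hz
  have hz0 : z ≠ 0 := by
    rintro rfl
    rw [zero_pow (by omega)] at hz
    simp at hz
    linarith
  have hzp : 0 < ‖z‖ := norm_pos_iff.mpr hz0
  have hm0 : (m:ℝ) ≠ 0 := by positivity
  have e : ‖z‖ ^ j * ‖z ^ m‖ ^ (((i:ℝ) - j) / m) = ‖z‖ ^ i := by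
    rw [norm_pow, ← Real.rpow_natCast ‖z‖ m, ← Real.rpow_natCast ‖z‖ j, ← Real.rpow_natCast ‖z‖ i,
      ← Real.rpow_mul hzp.le, ← Real.rpow_add hzp]
    congr 1
    field_simp
    ring
  rw [norm_mul, norm_pow, ← e]
  constructor
  · calc _ = ‖z‖ ^ j * ((1 - δ) * ‖z ^ m‖ ^ (((i:ℝ) - j) / m)) := by ring
      _ ≤ _ := by gcongr
  · calc _ ≤ ‖z‖ ^ j * ((1 + δ) * ‖z ^ m‖ ^ (((i:ℝ) - j) / m)) := by gcongr
      _ = _ := by ring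

theorem aux_expand (φ : ℕ → Polynomial ℂ) (hd : ∀ n, (φ n).natDegree = n)
    (hl : ∀ n, (φ n).leadingCoeff ≠ 0) (n : ℕ) (P : Polynomial ℂ) (hP : P.natDegree < n) :
    ∃ c : ℕ → ℂ, P = ∑ j ∈ Finset.range n, Polynomial.C (c j) * φ j := by
  induction n generalizing P with
  | zero => omega
  | succ k ih =>
    set a := P.coeff k / (φ k).leadingCoeff with ha
    rcases Nat.eq_zero_or_pos k with hk | hk
    · subst hk
      refine ⟨fun _ => a, ?_⟩
      have h1 := Polynomial.eq_C_of_natDegree_eq_zero (p := P) (by omega)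
      have h2 := Polynomial.eq_C_of_natDegree_eq_zero (hd 0)
      have h3 : (φ 0).leadingCoeff = (φ 0).coeff 0 := by rw [Polynomial.leadingCoeff, hd 0]
      have h4 := hl 0
      rw [h3] at ha h4
      simp only [zero_add, Finset.range_one, Finset.sum_singleton]
      rw [h2, h1, ← Polynomial.C_mul, ha]
      congr 1
      field_simp
    · have hlt : (P - Polynomial.C a * φ k).natDegree < k := by
        have hle : (P - Polynomial.C a * φ k).natDegree ≤ k := by
          refine (Polynomial.natDegree_sub_le _ _).trans (max_le (by omega) ?_)
          exact (Polynomial.natDegree_C_mul_le _ _).trans (hd k).le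
        rcases hle.lt_or_eq with h | h
        · exact h
        · exfalso
          have h0 : (P - Polynomial.C a * φ k).coeff k = 0 := by
            rw [Polynomial.coeff_sub, Polynomial.coeff_C_mul]
            have : (φ k).coeff k = (φ k).leadingCoeff := by rw [Polynomial.leadingCoeff, hd k]
            rw [this, ha, div_mul_cancel₀ _ (hl k), sub_self]
          have h1 : (P - Polynomial.C a * φ k).leadingCoeff = 0 := by
            rw [Polynomial.leadingCoeff, h, h0]
          rw [Polynomial.leadingCoeff_eq_zero] at h1
          rw [h1] at h
          simp at h
          omega
      obtain ⟨c, hc⟩ := ih _ hlt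
      refine ⟨fun j => if j = k then a else c j, ?_⟩
      rw [Finset.sum_range_succ]
      have : ∑ j ∈ Finset.range k, Polynomial.C (if j = k then a else c j) * φ j
          = ∑ j ∈ Finset.range k, Polynomial.C (c j) * φ j := by
        apply Finset.sum_congr rfl
        intro j hj
        rw [if_neg (Finset.mem_range.mp hj).ne]
      rw [this, ← hc]
      simp

theorem aux_L2 (G : Set ℂ) (hG : Bornology.IsBounded G) (φ : ℕ → Polynomial ℂ) (κ : ℕ → ℝ)
    (hON : IsOrthonormalPolys (volume.restrict G) φ κ) (n : ℕ) (c : ℕ → ℂ) :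
    ∫ z in G, ‖(∑ j ∈ Finset.range n, Polynomial.C (c j) * φ j : Polynomial ℂ).eval z‖ ^ 2
      = ∑ j ∈ Finset.range n, ‖c j‖ ^ 2 := by
  have hc : ∀ i, Continuous fun u : ℂ => (φ i).eval u := fun i => (φ i).continuous
  have e : ∀ z : ℂ, (∑ j ∈ Finset.range n, Polynomial.C (c j) * φ j : Polynomial ℂ).eval z
      = ∑ j ∈ Finset.range n, c j * (φ j).eval z := by
    intro z; simp [Polynomial.eval_finsetSum]
  simp only [e]
  have e2 : ∀ i j z, c i * (φ i).eval z * conj (c j * (φ j).eval z)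
      = (c i * conj (c j)) * ((φ i).eval z * conj ((φ j).eval z)) := by
    intro i j z; rw [map_mul]; ring
  rw [aux_pythag (volume.restrict G) (Finset.range n) (fun j z => c j * (φ j).eval z)]
  · apply Finset.sum_congr rfl
    intro j _
    have h := hON.orthonormal j j
    rw [if_pos rfl] at h
    have h1 : ∫ z in G, ‖(φ j).eval z‖ ^ 2 = 1 := by
      apply Complex.ofReal_injective
      rw [← integral_complex_ofReal, Complex.ofReal_one, ← h]
      congr 1
      ext z
      rw [Complex.mul_conj, Complex.normSq_eq_norm_sq]
    simp only [norm_mul, mul_pow]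
    rw [integral_const_mul, h1, mul_one]
  · intro i _ j _
    have := hc i
    have := hc j
    exact aux_int _ (by fun_prop) _ hG
  · intro i _ j _ hij
    simp only [e2]
    rw [integral_const_mul, hON.orthonormal i j, if_neg hij, mul_zero]

/-- real diagonal kernel -/
noncomputable def auxK (φ : ℕ → Polynomial ℂ) (n : ℕ) (z : ℂ) : ℝ :=
  ∑ j ∈ Finset.range (n + 1), ‖(φ j).eval z‖ ^ 2

theorem auxK_eq (φ : ℕ → Polynomial ℂ) (n : ℕ) (z : ℂ) :
    repKernel φ n z z = (auxK φ n z : ℂ) := by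
  unfold repKernel auxK
  push_cast
  apply Finset.sum_congr rfl
  intro j _
  rw [Complex.mul_conj']

theorem auxK_lower (G : Set ℂ) (hG : Bornology.IsBounded G) (φ : ℕ → Polynomial ℂ) (κ : ℕ → ℝ)
    (hON : IsOrthonormalPolys (volume.restrict G) φ κ) (n : ℕ) (P : Polynomial ℂ)
    (hP : P.natDegree ≤ n) (z₀ : ℂ) :
    ‖P.eval z₀‖ ^ 2 ≤ auxK φ n z₀ * ∫ z in G, ‖P.eval z‖ ^ 2 := by
  obtain ⟨c, hc⟩ := aux_expand φ hON.natDegree_eq (fun k => by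
    rw [hON.lead_eq]
    exact_mod_cast (hON.lead_pos k).ne') (n + 1) P (by omega)
  rw [hc, aux_L2 G hG φ κ hON, auxK]
  have h1 : ‖(∑ j ∈ Finset.range (n + 1), Polynomial.C (c j) * φ j : Polynomial ℂ).eval z₀‖
      ≤ ∑ j ∈ Finset.range (n + 1), ‖(φ j).eval z₀‖ * ‖c j‖ := by
    rw [Polynomial.eval_finsetSum]
    refine (norm_sum_le _ _).trans (le_of_eq ?_)
    apply Finset.sum_congr rfl
    intro j _
    simp [mul_comm]
  refine (pow_le_pow_left₀ (norm_nonneg _) h1 2).trans ?_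
  exact Finset.sum_mul_sq_le_sq_mul_sq _ _ _

theorem auxK_upper (G : Set ℂ) (hG : Bornology.IsBounded G) (φ : ℕ → Polynomial ℂ) (κ : ℕ → ℝ)
    (hON : IsOrthonormalPolys (volume.restrict G) φ κ) (n : ℕ) (z₀ : ℂ) (M : ℝ) (hM : 0 ≤ M)
    (h : ∀ P : Polynomial ℂ, P.natDegree ≤ n → ‖P.eval z₀‖ ^ 2 ≤ M * ∫ z in G, ‖P.eval z‖ ^ 2) :
    auxK φ n z₀ ≤ M := by
  have h1 := h (∑ j ∈ Finset.range (n + 1), Polynomial.C (conj ((φ j).eval z₀)) * φ j) (by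
    apply Polynomial.natDegree_sum_le_of_forall_le
    intro j hj
    refine (Polynomial.natDegree_C_mul_le _ _).trans ?_
    rw [hON.natDegree_eq]
    have := Finset.mem_range.mp hj
    omega)
  rw [aux_L2 G hG φ κ hON] at h1
  have h2 : (∑ j ∈ Finset.range (n + 1), Polynomial.C (conj ((φ j).eval z₀)) * φ j : Polynomial ℂ).eval z₀
      = (auxK φ n z₀ : ℂ) := by
    rw [← auxK_eq, repKernel, Polynomial.eval_finsetSum]
    apply Finset.sum_congr rfl
    intro j _
    simp [mul_comm]
  have hK : 0 ≤ auxK φ n z₀ := Finset.sum_nonneg (fun _ _ => by positivity)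
  rw [h2, Complex.norm_real, Real.norm_of_nonneg hK] at h1
  simp only [RCLike.norm_conj] at h1
  change auxK φ n z₀ ^ 2 ≤ M * auxK φ n z₀ at h1
  rcases hK.eq_or_lt with h0 | h0
  · rw [← h0]; exact hM
  · nlinarith

theorem aux_decomp (m : ℕ) (hm : 2 ≤ m) (n : ℕ) (P : Polynomial ℂ) (hP : P.natDegree ≤ n) :
    ∃ q : ℕ → Polynomial ℂ, (∀ j, (q j).natDegree ≤ n / m) ∧
      ∀ z : ℂ, P.eval z = ∑ j ∈ Finset.range m, z ^ j * (q j).eval (z ^ m) := by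
  refine ⟨fun j => ∑ l ∈ Finset.range (n / m + 1),
    Polynomial.C (P.coeff (m * l + j)) * Polynomial.X ^ l, ?_, ?_⟩
  · intro j
    apply Polynomial.natDegree_sum_le_of_forall_le
    intro l hl
    have := Finset.mem_range.mp hl
    exact (Polynomial.natDegree_C_mul_X_pow_le _ _).trans (by omega)
  · intro z
    have h0 : n < m * (n / m + 1) := Nat.lt_mul_div_succ n (by omega)
    rw [Polynomial.eval_eq_sum_range' (n := m * (n / m + 1)) (by omega)]
    have key : ∀ k : ℕ, ∑ i ∈ Finset.range (m * k), P.coeff i * z ^ i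
        = ∑ l ∈ Finset.range k, ∑ j ∈ Finset.range m, P.coeff (m * l + j) * z ^ (m * l + j) := by
      intro k
      induction k with
      | zero => simp
      | succ k ih => rw [Nat.mul_succ, Finset.sum_range_add, ih, Finset.sum_range_succ]
    rw [key, Finset.sum_comm]
    apply Finset.sum_congr rfl
    intro j _
    rw [Polynomial.eval_finsetSum, Finset.mul_sum]
    apply Finset.sum_congr rfl
    intro l _
    simp only [Polynomial.eval_mul, Polynomial.eval_C, Polynomial.eval_pow, Polynomial.eval_X]
    ring

theorem aux_upper (r : ℝ) (hr0 : 0 < r) (m : ℕ) (hm : 2 ≤ m) (hr1 : r ^ m < 1)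
    (φ : ℕ → Polynomial ℂ) (κ : ℕ → ℝ)
    (hON : IsOrthonormalPolys (volume.restrict (lemniscate r m)) φ κ)
    (δ : ℝ) (hδ : 0 < δ) (hδ1 : δ < 1) :
    ∃ s : ℕ, ∀ n : ℕ, ∀ z₀ : ℂ, ‖z₀ ^ m - 1‖ = r ^ m →
      auxK φ n z₀ ≤ ((1 + δ) / (1 - δ)) ^ 2 * (m ^ 2 * ‖z₀‖ ^ (2 * m - 2) / (Real.pi * r ^ (2 * m)))
        * auxSg (n / m + s) := by
  choose T hT using fun j => aux_approx r hr0 m hm hr1 j (m - 1) δ hδ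
  refine ⟨∑ j ∈ Finset.range m, (T j).natDegree + 1, fun n z₀ hz₀ => ?_⟩
  set s := ∑ j ∈ Finset.range m, (T j).natDegree + 1 with hs
  have hsg : 0 ≤ auxSg (n / m + s) := by rw [auxSg_eq]; positivity
  apply auxK_upper _ (aux_bdd r m hm hr1) φ κ hON
  · positivity
  intro P hP
  obtain ⟨q, hq, hPq⟩ := aux_decomp m hm n P hP
  simp only [hPq]
  rw [aux_mod r m hm hr1 q]
  set I : ℕ → ℝ := fun j => ∫ z in lemniscate r m, ‖z ^ j * (q j).eval (z ^ m)‖ ^ 2 with hI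
  have hδ' : 0 < 1 - δ := by linarith
  have hdp : 0 < Real.pi * r ^ (2 * m) := by positivity
  have hterm : ∀ j ∈ Finset.range m, ‖z₀ ^ j * (q j).eval (z₀ ^ m)‖ ^ 2 ≤
      ((1 + δ) / (1 - δ)) ^ 2 * (m * ‖z₀‖ ^ (2 * m - 2) / (Real.pi * r ^ (2 * m)))
        * auxSg (n / m + s) * I j := by
    intro j hj
    have hdeg : (q j * T j).natDegree < n / m + s := by
      have h1 := Polynomial.natDegree_mul_le (p := q j) (q := T j)
      have h2 := hq j
      have h3 : (T j).natDegree ≤ ∑ j ∈ Finset.range m, (T j).natDegree :=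
        Finset.single_le_sum (f := fun j => (T j).natDegree) (fun _ _ => Nat.zero_le _) hj
      omega
    have hpt := aux_point r hr0 m hm (q j * T j) (n / m + s) hdeg (z₀ ^ m) hz₀
    have hint : ∫ z in lemniscate r m, ‖z ^ (m - 1) * (q j * T j).eval (z ^ m)‖ ^ 2
        ≤ (1 + δ) ^ 2 * I j := by
      rw [hI, ← integral_const_mul]
      have c1 : Continuous fun u : ℂ => (q j).eval u := (q j).continuous
      have c2 : Continuous fun u : ℂ => (q j * T j).eval u := (q j * T j).continuous
      apply setIntegral_mono_on
      · exact aux_intR _ (by fun_prop) _ (aux_bdd r m hm hr1)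
      · exact aux_intR _ (by fun_prop) _ (aux_bdd r m hm hr1)
      · exact aux_meas r m
      · intro z hz
        have h1 := (hT j z (le_of_lt hz)).2
        rw [← mul_pow]
        apply pow_le_pow_left₀ (norm_nonneg _)
        calc ‖z ^ (m - 1) * (q j * T j).eval (z ^ m)‖
            = ‖z ^ (m - 1) * (T j).eval (z ^ m)‖ * ‖(q j).eval (z ^ m)‖ := by
              rw [Polynomial.eval_mul, ← norm_mul]; congr 1; ring
          _ ≤ ((1 + δ) * ‖z‖ ^ j) * ‖(q j).eval (z ^ m)‖ := by gcongr
          _ = _ := by rw [norm_mul, norm_pow]; ring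
    have h1 := (hT j z₀ hz₀.le).1
    have h2 : (1 - δ) * ‖z₀ ^ j * (q j).eval (z₀ ^ m)‖
        ≤ ‖z₀‖ ^ (m - 1) * ‖(q j * T j).eval (z₀ ^ m)‖ := by
      calc _ = ((1 - δ) * ‖z₀‖ ^ j) * ‖(q j).eval (z₀ ^ m)‖ := by
            rw [norm_mul, norm_pow]; ring
        _ ≤ ‖z₀ ^ (m - 1) * (T j).eval (z₀ ^ m)‖ * ‖(q j).eval (z₀ ^ m)‖ := by gcongr
        _ = _ := by rw [Polynomial.eval_mul, norm_mul, norm_mul, norm_pow]; ring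
    have h3 := pow_le_pow_left₀ (by positivity) h2 2
    have e1 : (‖z₀‖ ^ (m - 1)) ^ 2 = ‖z₀‖ ^ (2 * m - 2) := by
      rw [← pow_mul]; congr 1; omega
    rw [mul_pow, mul_pow, e1] at h3
    have h4 : ‖z₀ ^ j * (q j).eval (z₀ ^ m)‖ ^ 2 ≤
        ‖z₀‖ ^ (2 * m - 2) * ‖(q j * T j).eval (z₀ ^ m)‖ ^ 2 / (1 - δ) ^ 2 := by
      rw [le_div_iff₀ (by positivity)]; linarith
    refine h4.trans ?_
    calc _ ≤ ‖z₀‖ ^ (2 * m - 2) * (auxSg (n / m + s) / (Real.pi * r ^ (2 * m)) * (m *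
            ((1 + δ) ^ 2 * I j))) / (1 - δ) ^ 2 := by
          gcongr
          refine hpt.trans ?_
          gcongr
      _ = _ := by field_simp
  calc ‖∑ j ∈ Finset.range m, z₀ ^ j * (q j).eval (z₀ ^ m)‖ ^ 2
      ≤ (∑ j ∈ Finset.range m, ‖z₀ ^ j * (q j).eval (z₀ ^ m)‖) ^ 2 :=
        pow_le_pow_left₀ (norm_nonneg _) (norm_sum_le _ _) 2
    _ ≤ m * ∑ j ∈ Finset.range m, ‖z₀ ^ j * (q j).eval (z₀ ^ m)‖ ^ 2 := by
        have := sq_sum_le_card_mul_sum_sq (s := Finset.range m)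
          (f := fun j => ‖z₀ ^ j * (q j).eval (z₀ ^ m)‖)
        rwa [Finset.card_range] at this
    _ ≤ m * ∑ j ∈ Finset.range m, ((1 + δ) / (1 - δ)) ^ 2 *
          (m * ‖z₀‖ ^ (2 * m - 2) / (Real.pi * r ^ (2 * m))) * auxSg (n / m + s) * I j := by
        gcongr with j hj
        exact hterm j hj
    _ = _ := by
        rw [← Finset.mul_sum]
        ring

theorem aux_testQ (r : ℝ) (hr0 : 0 < r) (m : ℕ) (hm : 2 ≤ m) (M : ℕ) (hM : 0 < M) (u : ℂ)
    (hu : ‖u - 1‖ = r ^ m) :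
    ∃ Q : Polynomial ℂ, Q.natDegree < M ∧ Q.eval u = (auxSg M : ℂ) ∧
      m * ∫ z in lemniscate r m, ‖z ^ (m - 1) * Q.eval (z ^ m)‖ ^ 2
        = Real.pi * r ^ (2 * m) * auxSg M := by
  have hm0 : (m:ℝ) ≠ 0 := by positivity
  have hr' := hr0.ne'
  set a : ℕ → ℂ := fun l => ((l:ℂ) + 1) * (conj (u - 1)) ^ l / ((r ^ m : ℝ) : ℂ) ^ (2 * l) with ha
  set q : Polynomial ℂ := ∑ l ∈ Finset.range M, Polynomial.C (a l) * Polynomial.X ^ l with hq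
  have hqd : q.natDegree < M := by
    have : q.natDegree ≤ M - 1 := by
      apply Polynomial.natDegree_sum_le_of_forall_le
      intro l hl
      have := Finset.mem_range.mp hl
      exact (Polynomial.natDegree_C_mul_X_pow_le _ _).trans (by omega)
    omega
  have hqc : ∀ l ∈ Finset.range M, q.coeff l = a l := by
    intro l hl
    rw [hq, Polynomial.finsetSum_coeff]
    simp only [Polynomial.coeff_C_mul, Polynomial.coeff_X_pow]
    simp
    intro h
    have := Finset.mem_range.mp hl
    omega
  have htay : Polynomial.taylor 1 (Polynomial.taylor (-1) q) = q := by
    rw [Polynomial.taylor_taylor]; simp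
  have hQd : (Polynomial.taylor (-1) q).natDegree < M := by rwa [Polynomial.natDegree_taylor]
  refine ⟨Polynomial.taylor (-1) q, hQd, ?_, ?_⟩
  · rw [Polynomial.taylor_eval, ← sub_eq_add_neg, hq, Polynomial.eval_finsetSum, auxSg]
    push_cast
    apply Finset.sum_congr rfl
    intro l _
    simp only [Polynomial.eval_mul, Polynomial.eval_C, Polynomial.eval_pow, Polynomial.eval_X, ha]
    have h1 : (conj (u - 1)) ^ l * (u - 1) ^ l = ((r ^ m : ℝ) : ℂ) ^ (2 * l) := by
      rw [← mul_pow, Complex.conj_mul', hu, ← pow_mul]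
    have h2 : ((r ^ m : ℝ) : ℂ) ^ (2 * l) ≠ 0 := by
      apply pow_ne_zero
      exact_mod_cast (pow_pos hr0 m).ne'
    rw [div_mul_eq_mul_div, mul_assoc, h1, mul_div_assoc, div_self h2, mul_one]
  · rw [aux_G r m hm, aux_ball (r ^ m) (by positivity) _ M hQd, htay, ← mul_assoc,
      mul_one_div_cancel hm0, one_mul, auxSg, Finset.mul_sum]
    apply Finset.sum_congr rfl
    intro l hl
    rw [hqc l hl]
    have h1 : ‖a l‖ = ((l:ℝ) + 1) / (r ^ m) ^ l := by
      rw [ha]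
      simp only [norm_div, norm_mul, norm_pow, RCLike.norm_conj, hu, Complex.norm_real]
      have : ‖(l:ℂ) + 1‖ = (l:ℝ) + 1 := by
        rw [show (l:ℂ) + 1 = ((l + 1 : ℕ) : ℂ) by push_cast; ring, Complex.norm_natCast]
        push_cast; ring
      rw [this, Real.norm_of_nonneg hr0.le]
      field_simp
      ring
    rw [h1]
    have : ((l:ℝ) + 1) ≠ 0 := by positivity
    field_simp
    ring

theorem aux_lower (r : ℝ) (hr0 : 0 < r) (m : ℕ) (hm : 2 ≤ m) (hr1 : r ^ m < 1)
    (φ : ℕ → Polynomial ℂ) (κ : ℕ → ℝ)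
    (hON : IsOrthonormalPolys (volume.restrict (lemniscate r m)) φ κ)
    (δ : ℝ) (hδ : 0 < δ) (hδ1 : δ < 1) :
    ∃ s : ℕ, ∀ n : ℕ, ∀ z₀ : ℂ, ‖z₀ ^ m - 1‖ = r ^ m →
      ((1 - δ) / (1 + δ)) ^ 2 * (m ^ 2 * ‖z₀‖ ^ (2 * m - 2) / (Real.pi * r ^ (2 * m)))
        * auxSg (n / m - s) ≤ auxK φ n z₀ := by
  choose S hS using fun j => aux_approx r hr0 m hm hr1 (m - 1) j δ hδ
  refine ⟨∑ j ∈ Finset.range m, (S j).natDegree, fun n z₀ hz₀ => ?_⟩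
  set s := ∑ j ∈ Finset.range m, (S j).natDegree with hs
  have hK : 0 ≤ auxK φ n z₀ := Finset.sum_nonneg (fun _ _ => by positivity)
  rcases Nat.eq_zero_or_pos (n / m - s) with h0 | hM
  · rw [h0, auxSg_eq]; simpa using hK
  set M := n / m - s with hMdef
  have hsg : 0 < auxSg M := by
    rw [auxSg_eq]; positivity
  obtain ⟨Q, hQd, hQu, hQi⟩ := aux_testQ r hr0 m hm M hM (z₀ ^ m) hz₀
  choose c hc1 hc2 using fun j => RCLike.exists_norm_eq_mul_self (K := ℂ) (z₀ ^ j * (S j).eval (z₀ ^ m))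
  set f : ℕ → Polynomial ℂ := fun j => Polynomial.C (c j) * (S j * Q) with hf
  have hfe : ∀ j u, (f j).eval u = c j * ((S j).eval u * Q.eval u) := by
    intro j u; simp [hf]
  set P : Polynomial ℂ := ∑ j ∈ Finset.range m, Polynomial.X ^ j * (f j).comp (Polynomial.X ^ m)
    with hP
  have hPe : ∀ z, P.eval z = ∑ j ∈ Finset.range m, z ^ j * (f j).eval (z ^ m) := by
    intro z
    rw [hP, Polynomial.eval_finsetSum]
    simp [Polynomial.eval_comp]
  have hPd : P.natDegree ≤ n := by
    apply Polynomial.natDegree_sum_le_of_forall_le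
    intro j hj
    refine (Polynomial.natDegree_mul_le).trans ?_
    rw [Polynomial.natDegree_X_pow, Polynomial.natDegree_comp, Polynomial.natDegree_X_pow]
    have h1 : (f j).natDegree ≤ (S j).natDegree + Q.natDegree :=
      (Polynomial.natDegree_C_mul_le _ _).trans Polynomial.natDegree_mul_le
    have h2 : (S j).natDegree ≤ s :=
      Finset.single_le_sum (f := fun j => (S j).natDegree) (fun _ _ => Nat.zero_le _) hj
    have h3 : (f j).natDegree + 1 ≤ n / m := by omega
    have h4 := Nat.mul_le_mul_right m h3
    have h5 := Nat.div_mul_le_self n m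
    have h6 := Finset.mem_range.mp hj
    rw [add_mul] at h4
    omega
  have hlow := auxK_lower _ (aux_bdd r m hm hr1) φ κ hON n P hPd z₀
  have hint : ∫ z in lemniscate r m, ‖P.eval z‖ ^ 2 ≤
      (1 + δ) ^ 2 * (Real.pi * r ^ (2 * m) * auxSg M) := by
    simp only [hPe]
    rw [aux_mod r m hm hr1 f, ← hQi]
    calc _ ≤ ∑ j ∈ Finset.range m, (1 + δ) ^ 2 *
          ∫ z in lemniscate r m, ‖z ^ (m - 1) * Q.eval (z ^ m)‖ ^ 2 := by
          apply Finset.sum_le_sum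
          intro j hj
          rw [← integral_const_mul]
          have c1 : Continuous fun u : ℂ => (f j).eval u := (f j).continuous
          have c2 : Continuous fun u : ℂ => Q.eval u := Q.continuous
          apply setIntegral_mono_on
          · exact aux_intR _ (by fun_prop) _ (aux_bdd r m hm hr1)
          · exact aux_intR _ (by fun_prop) _ (aux_bdd r m hm hr1)
          · exact aux_meas r m
          · intro z hz
            have h1 := (hS j z (le_of_lt hz)).2
            rw [← mul_pow]
            apply pow_le_pow_left₀ (norm_nonneg _)
            calc ‖z ^ j * (f j).eval (z ^ m)‖
                = ‖z ^ j * (S j).eval (z ^ m)‖ * ‖Q.eval (z ^ m)‖ := by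
                  rw [hfe, norm_mul, norm_mul, hc1, norm_mul, norm_mul]; ring
              _ ≤ ((1 + δ) * ‖z‖ ^ (m - 1)) * ‖Q.eval (z ^ m)‖ := by gcongr
              _ = _ := by rw [norm_mul, norm_pow]; ring
      _ = _ := by
          rw [Finset.sum_const, Finset.card_range, nsmul_eq_mul]; ring
  have hval : m * ((1 - δ) * ‖z₀‖ ^ (m - 1)) * auxSg M ≤ ‖P.eval z₀‖ := by
    have e : P.eval z₀ = (((∑ j ∈ Finset.range m, ‖z₀ ^ j * (S j).eval (z₀ ^ m)‖) * auxSg M : ℝ) : ℂ) := by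
      rw [hPe]
      push_cast
      rw [Finset.sum_mul]
      apply Finset.sum_congr rfl
      intro j _
      rw [hfe, hQu]
      have := hc2 j
      simp only [Complex.coe_algebraMap] at this
      have h2 : ((‖z₀ ^ j * (S j).eval (z₀ ^ m)‖ : ℝ) : ℂ) = c j * (z₀ ^ j * (S j).eval (z₀ ^ m)) := this
      rw [h2]
      ring
    rw [e, Complex.norm_real, Real.norm_of_nonneg (by positivity)]
    gcongr
    calc m * ((1 - δ) * ‖z₀‖ ^ (m - 1)) = ∑ j ∈ Finset.range m, ((1 - δ) * ‖z₀‖ ^ (m - 1)) := by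
          rw [Finset.sum_const, Finset.card_range, nsmul_eq_mul]
      _ ≤ _ := Finset.sum_le_sum (fun j _ => (hS j z₀ hz₀.le).1)
  have hδ' : 0 < 1 - δ := by linarith
  have h1 := (pow_le_pow_left₀ (by positivity) hval 2).trans
    (hlow.trans (mul_le_mul_of_nonneg_left hint hK))
  have e1 : (‖z₀‖ ^ (m - 1)) ^ 2 = ‖z₀‖ ^ (2 * m - 2) := by
    rw [← pow_mul]; congr 1; omega
  have h2 : (m ^ 2 * (1 - δ) ^ 2 * ‖z₀‖ ^ (2 * m - 2) * auxSg M) * auxSg M ≤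
      (auxK φ n z₀ * ((1 + δ) ^ 2 * (Real.pi * r ^ (2 * m)))) * auxSg M := by
    rw [← e1]
    calc _ = (m * ((1 - δ) * ‖z₀‖ ^ (m - 1)) * auxSg M) ^ 2 := by ring
      _ ≤ _ := h1
      _ = _ := by ring
  have h3 := le_of_mul_le_mul_right h2 hsg
  have hp : 0 < (1 + δ) ^ 2 * (Real.pi * r ^ (2 * m)) := by positivity
  rw [← div_le_iff₀ hp] at h3
  refine le_trans (le_of_eq ?_) h3
  field_simp

theorem aux_lim0 (m : ℕ) (hm : 2 ≤ m) (x : ℕ → ℕ)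
    (hx : Tendsto (fun n : ℕ => (x n : ℝ) / n) atTop (𝓝 (1 / m))) :
    Tendsto (fun n : ℕ => 2 * (m:ℝ) ^ 2 * auxSg (x n) / (n:ℝ) ^ 2) atTop (𝓝 1) := by
  have h1 : Tendsto (fun n : ℕ => (m:ℝ) ^ 2 * ((x n : ℝ) / n * ((x n : ℝ) / n + 1 / n))) atTop
      (𝓝 ((m:ℝ) ^ 2 * (1 / m * (1 / m + 0)))) :=
    tendsto_const_nhds.mul (hx.mul (hx.add tendsto_one_div_atTop_nhds_zero_nat))
  have hm0 : (m:ℝ) ≠ 0 := by positivity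
  have e : (m:ℝ) ^ 2 * (1 / m * (1 / m + 0)) = 1 := by field_simp; ring
  rw [e] at h1
  refine h1.congr' ?_
  filter_upwards [eventually_gt_atTop 0] with n hn
  have hn0 : (n:ℝ) ≠ 0 := by positivity
  rw [auxSg_eq]
  field_simp

theorem aux_lim1 (m : ℕ) (hm : 2 ≤ m) :
    Tendsto (fun n : ℕ => ((n / m : ℕ) : ℝ) / n) atTop (𝓝 (1 / m)) := by
  have h := (tendsto_nat_floor_mul_div_atTop (R := ℝ) (a := 1 / m) (by positivity)).comp
    (tendsto_natCast_atTop_atTop (R := ℝ))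
  refine h.congr ?_
  intro n
  simp only [Function.comp]
  rw [show (1 / (m:ℝ)) * n = (n:ℝ) / m by ring, Nat.floor_div_natCast, Nat.floor_natCast]

theorem aux_limU (m : ℕ) (hm : 2 ≤ m) (s : ℕ) :
    Tendsto (fun n : ℕ => 2 * (m:ℝ) ^ 2 * auxSg (n / m + s) / (n:ℝ) ^ 2) atTop (𝓝 1) := by
  apply aux_lim0 m hm (fun n => n / m + s)
  have := (aux_lim1 m hm).add (tendsto_const_div_atTop_nhds_zero_nat (s:ℝ))
  rw [add_zero] at this
  refine this.congr (fun n => ?_)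
  push_cast
  ring

theorem aux_limL (m : ℕ) (hm : 2 ≤ m) (s : ℕ) :
    Tendsto (fun n : ℕ => 2 * (m:ℝ) ^ 2 * auxSg (n / m - s) / (n:ℝ) ^ 2) atTop (𝓝 1) := by
  apply aux_lim0 m hm (fun n => n / m - s)
  have := (aux_lim1 m hm).sub (tendsto_const_div_atTop_nhds_zero_nat (s:ℝ))
  rw [sub_zero] at this
  refine this.congr' ?_
  filter_upwards [eventually_ge_atTop (s * m)] with n hn
  have : s ≤ n / m := (Nat.le_div_iff_mul_le (by omega)).mpr hn
  rw [Nat.cast_sub this]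
  ring

theorem aux_delta (ε : ℝ) (hε : 0 < ε) : ∃ δ : ℝ, 0 < δ ∧ δ < 1 ∧
    ((1 + δ) / (1 - δ)) ^ 2 < 1 + ε ∧ 1 - ε < ((1 - δ) / (1 + δ)) ^ 2 := by
  have h1 : Tendsto (fun δ : ℝ => ((1 + δ) / (1 - δ)) ^ 2) (𝓝[>] 0) (𝓝 1) := by
    have : ContinuousAt (fun δ : ℝ => ((1 + δ) / (1 - δ)) ^ 2) 0 := by
      apply ContinuousAt.pow
      apply ContinuousAt.div (by fun_prop) (by fun_prop) (by norm_num)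
    have h := this.tendsto
    simp only [add_zero, sub_zero, div_one, one_pow] at h
    exact h.mono_left nhdsWithin_le_nhds
  have h2 : Tendsto (fun δ : ℝ => ((1 - δ) / (1 + δ)) ^ 2) (𝓝[>] 0) (𝓝 1) := by
    have : ContinuousAt (fun δ : ℝ => ((1 - δ) / (1 + δ)) ^ 2) 0 := by
      apply ContinuousAt.pow
      apply ContinuousAt.div (by fun_prop) (by fun_prop) (by norm_num)
    have h := this.tendsto
    simp only [add_zero, sub_zero, div_one, one_pow] at h
    exact h.mono_left nhdsWithin_le_nhds
  have h3 : ∀ᶠ δ : ℝ in 𝓝[>] 0, δ ∈ Ioo (0:ℝ) 1 := Ioo_mem_nhdsGT one_pos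
  obtain ⟨δ, ha, hb, hc⟩ := ((h1.eventually_lt_const (show (1:ℝ) < 1 + ε by linarith)).and
    ((h2.eventually_const_lt (show 1 - ε < (1:ℝ) by linarith)).and h3)).exists
  exact ⟨δ, hc.1, hc.2, ha, hb⟩

/-- **Corollary 3.8.** Diagonal kernel asymptotics for area measure on the lemniscate
`G_{r,m}`, uniformly for `z₀` in a compact subset of the boundary. -/
theorem statement_18
    (r : ℝ) (hr0 : 0 < r) (hr1 : r < 1) (m : ℕ) (hm : 2 ≤ m)
    (φ : ℕ → Polynomial ℂ) (κ : ℕ → ℝ)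
    (hON : IsOrthonormalPolys (volume.restrict (lemniscate r m)) φ κ)
    (J : Set ℂ) (hJc : IsCompact J) (hJ : J ⊆ frontier (lemniscate r m)) :
    TendstoUniformlyOn
      (fun (n : ℕ) (z₀ : ℂ) => repKernel φ n z₀ z₀ / (n:ℂ) ^ 2)
      (fun z₀ => ((‖z₀‖ ^ (2 * m - 2) : ℝ) : ℂ)
        / (((2 * Real.pi * r ^ (2 * m) : ℝ)) : ℂ))
      atTop J := by
  have hρ1 : r ^ m < 1 := pow_lt_one₀ hr0.le hr1 (by omega)
  have hfr : ∀ z ∈ J, ‖z ^ m - 1‖ = r ^ m := by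
    intro z hz
    exact frontier_lt_subset_eq (f := fun z : ℂ => ‖z ^ m - 1‖) (g := fun _ => r ^ m)
      (by fun_prop) (by fun_prop) (hJ hz)
  rw [Metric.tendstoUniformlyOn_iff]
  intro ε hε
  set B : ℝ := 2 ^ (2 * m - 2) / (2 * Real.pi * r ^ (2 * m)) with hB
  have hBpos : 0 < B := by positivity
  set η := ε / (2 * B) with hη
  have hηpos : 0 < η := by positivity
  obtain ⟨δ, hδ0, hδ1, hδu, hδl⟩ := aux_delta η hηpos
  obtain ⟨s, hs⟩ := aux_upper r hr0 m hm hρ1 φ κ hON δ hδ0 hδ1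
  obtain ⟨t, ht⟩ := aux_lower r hr0 m hm hρ1 φ κ hON δ hδ0 hδ1
  have hU := (aux_limU m hm s).const_mul (((1 + δ) / (1 - δ)) ^ 2)
  have hL := (aux_limL m hm t).const_mul (((1 - δ) / (1 + δ)) ^ 2)
  rw [mul_one] at hU hL
  filter_upwards [hU.eventually_lt_const hδu, hL.eventually_const_lt hδl,
    eventually_gt_atTop 0] with n hnU hnL hn z hz
  have hzf := hfr z hz
  set L : ℝ := ‖z‖ ^ (2 * m - 2) / (2 * Real.pi * r ^ (2 * m)) with hLdef
  have hL0 : 0 ≤ L := by positivity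
  have hLB : L ≤ B := by
    have := aux_normle r m hm hρ1 z hzf.le
    rw [hLdef, hB]
    gcongr
  have hn2 : (0:ℝ) < (n:ℝ) ^ 2 := by positivity
  have e0 : (m:ℝ) ^ 2 * ‖z‖ ^ (2 * m - 2) / (Real.pi * r ^ (2 * m)) = 2 * (m:ℝ) ^ 2 * L := by
    rw [hLdef]
    have := hr0.ne'
    have := Real.pi_ne_zero
    field_simp
  have h1 := hs n z hzf
  have h2 := ht n z hzf
  rw [e0] at h1 h2
  have h1' : auxK φ n z / (n:ℝ) ^ 2 ≤ L * (1 + η) := by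
    calc auxK φ n z / (n:ℝ) ^ 2 ≤ (((1 + δ) / (1 - δ)) ^ 2 * (2 * (m:ℝ) ^ 2 * L)
          * auxSg (n / m + s)) / (n:ℝ) ^ 2 := by gcongr
      _ = L * (((1 + δ) / (1 - δ)) ^ 2 * (2 * (m:ℝ) ^ 2 * auxSg (n / m + s) / (n:ℝ) ^ 2)) := by ring
      _ ≤ L * (1 + η) := by gcongr
  have h2' : L * (1 - η) ≤ auxK φ n z / (n:ℝ) ^ 2 := by
    calc L * (1 - η) ≤ L * (((1 - δ) / (1 + δ)) ^ 2 *
          (2 * (m:ℝ) ^ 2 * auxSg (n / m - t) / (n:ℝ) ^ 2)) := by gcongr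
      _ = (((1 - δ) / (1 + δ)) ^ 2 * (2 * (m:ℝ) ^ 2 * L)
          * auxSg (n / m - t)) / (n:ℝ) ^ 2 := by ring
      _ ≤ _ := by gcongr
  have hLη : L * η ≤ ε / 2 := by
    calc L * η ≤ B * η := by gcongr
      _ = ε / 2 := by rw [hη]; field_simp
  have e1 : ((‖z‖ ^ (2 * m - 2) : ℝ) : ℂ) / (((2 * Real.pi * r ^ (2 * m) : ℝ)) : ℂ) = (L : ℂ) := by
    rw [hLdef, Complex.ofReal_div]
  have e2 : repKernel φ n z z / (n:ℂ) ^ 2 = ((auxK φ n z / (n:ℝ) ^ 2 : ℝ) : ℂ) := by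
    rw [auxK_eq]; push_cast; rfl
  rw [e1, e2, Complex.dist_of_im_eq (by rw [Complex.ofReal_im, Complex.ofReal_im]), Complex.ofReal_re, Complex.ofReal_re, Real.dist_eq,
    abs_lt]
  constructor <;> linarith
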